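/- Let m, n ∈ ℕ with m ≥ 2 and n ≥ 2, m odd and n even. Then the Tornheim double series satisfies T(m,0,n) = ζ(m) ζ(n) − (1/2) ζ(m+n) + (−1)^{⌊(m+n)/2⌋} ((2π)^{m+n−1}/(m! n!)) · (1/2) ( m·I_BB(m−1,n) + n·I_BB(m,n−1) ). -/

import Mathlib

open Real MeasureTheory

/-- Hurwitz zeta as a real-valued function of real arguments. -/
noncomputable def hzeta (z q : ℝ) : ℝ := (HurwitzZeta.hurwitzZeta (q : UnitAddCircle) (z : ℂ)).re

/-- Riemann zeta as a real-valued function of a real argument. -/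
noncomputable def rzeta (s : ℝ) : ℝ := (riemannZeta (s : ℂ)).re

/-- Tornheim double series. -/
noncomputable def T (a b c : ℝ) : ℝ :=
  ∑' r : ℕ+, ∑' s : ℕ+, 1 / ((r : ℝ) ^ a * (s : ℝ) ^ b * ((r : ℝ) + (s : ℝ)) ^ c)

/-- Bernoulli polynomial evaluated at a real. -/
noncomputable def B (k : ℕ) (q : ℝ) : ℝ := Polynomial.aeval q (Polynomial.bernoulli k)

/-- The Bernoulli function `A_k(q) = k ζ'(1-k, q)`. -/
noncomputable def A (k : ℕ) (q : ℝ) : ℝ :=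
  k * (deriv (fun z : ℂ => HurwitzZeta.hurwitzZeta (q : UnitAddCircle) z) (1 - (k : ℂ))).re

/-- The kernel `K(q) = log sin (π q)`. -/
noncomputable def K (q : ℝ) : ℝ := Real.log (Real.sin (π * q))

noncomputable def I_AB (k l : ℕ) : ℝ := (1 / π) * ∫ q in (0:ℝ)..1, A k q * B l q * K q

noncomputable def I_BB (k l : ℕ) : ℝ := ∫ q in (0:ℝ)..1, B k q * B l q * K q

noncomputable def I_AA (k l : ℕ) : ℝ := (1 / π ^ 2) * ∫ q in (0:ℝ)..1, A k q * A l q * K q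

noncomputable def J_AA (k l : ℕ) : ℝ := (1 / π ^ 2) * ∫ q in (0:ℝ)..1, A k q * A l (1 - q) * K q

/-- The quotient `sin (2 π r q) / sin (π q)` as a trigonometric polynomial. -/
noncomputable def sinRatio (r : ℕ) (q : ℝ) : ℝ :=
  ∑ j ∈ Finset.range r, 2 * cos (π * (2 * j + 1) * q)

theorem continuous_sinRatio (r : ℕ) : Continuous (sinRatio r) := by
  unfold sinRatio
  fun_prop

theorem sin_mul_sinRatio (r : ℕ) (q : ℝ) :
    sin (π * q) * sinRatio r q = sin (2 * π * r * q) := by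
  induction r with
  | zero => simp [sinRatio]
  | succ r ih =>
    have h₁ : 2 * π * ((r + 1 : ℕ) : ℝ) * q = π * (2 * r + 1) * q + π * q := by
      push_cast
      ring
    have h₂ : 2 * π * (r : ℝ) * q = π * (2 * r + 1) * q - π * q := by ring
    rw [sinRatio, Finset.sum_range_succ, ← sinRatio, mul_add, ih, h₁, h₂, sin_add, sin_sub]
    ring

theorem abs_sinRatio_le (r : ℕ) (q : ℝ) : |sinRatio r q| ≤ 2 * r := by
  refine (Finset.abs_sum_le_sum_abs _ _).trans ?_
  refine (Finset.sum_le_sum (g := fun _ => (2 : ℝ)) fun j _ => ?_).trans (by simp [mul_comm])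
  rw [abs_mul, abs_two]
  linarith [abs_cos_le_one (π * (2 * j + 1) * q)]

theorem integral_cos_two_pi_int_mul {z : ℤ} (hz : z ≠ 0) :
    ∫ q in (0 : ℝ)..1, cos (2 * π * z * q) = 0 := by
  have hz' : (z : ℝ) ≠ 0 := by exact_mod_cast hz
  have h : 2 * π * (z : ℝ) ≠ 0 := by positivity
  rw [intervalIntegral.integral_comp_mul_left (fun x => cos x) h, integral_cos,
    show 2 * π * (z : ℝ) * 1 = ((2 * z : ℤ) : ℝ) * π by push_cast; ring, sin_int_mul_pi]
  simp

theorem integral_cos_mul_cos (j : ℕ) {k : ℕ} (hk : k ≠ 0) :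
    ∫ q in (0 : ℝ)..1, cos (2 * π * j * q) * cos (2 * π * k * q) =
      if j = k then 1 / 2 else 0 := by
  have h : ∀ q : ℝ, cos (2 * π * j * q) * cos (2 * π * k * q) =
      (1 / 2) * cos (2 * π * ((j + k : ℤ) : ℝ) * q) +
        (1 / 2) * cos (2 * π * ((j - k : ℤ) : ℝ) * q) := by
    intro q
    push_cast
    rw [show 2 * π * ((j : ℝ) + k) * q = 2 * π * j * q + 2 * π * k * q by ring,
      show 2 * π * ((j : ℝ) - k) * q = 2 * π * j * q - 2 * π * k * q by ring, cos_add, cos_sub]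
    ring
  simp_rw [h]
  rw [intervalIntegral.integral_add
      (Continuous.intervalIntegrable (by fun_prop) _ _)
      (Continuous.intervalIntegrable (by fun_prop) _ _),
    intervalIntegral.integral_const_mul, intervalIntegral.integral_const_mul,
    integral_cos_two_pi_int_mul (by omega : (j + k : ℤ) ≠ 0)]
  split_ifs with hjk
  · simp [hjk]
  · rw [integral_cos_two_pi_int_mul (by omega : (j - k : ℤ) ≠ 0)]
    simp

theorem integral_sinRatio_mul_cos_mul_cos (r : ℕ) {k : ℕ} (hk : k ≠ 0) :
    ∫ q in (0 : ℝ)..1, sinRatio r q * cos (π * q) * cos (2 * π * k * q) =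
      (if k < r then 1 / 2 else 0) + if k ≤ r then 1 / 2 else 0 := by
  induction r with
  | zero => simp [sinRatio, hk]
  | succ r ih =>
    have h : ∀ q : ℝ, sinRatio (r + 1) q * cos (π * q) * cos (2 * π * k * q) =
        sinRatio r q * cos (π * q) * cos (2 * π * k * q) +
          (cos (2 * π * (r + 1 : ℕ) * q) * cos (2 * π * k * q) +
            cos (2 * π * r * q) * cos (2 * π * k * q)) := by
      intro q
      rw [sinRatio, Finset.sum_range_succ, ← sinRatio]
      push_cast
      rw [show 2 * π * ((r : ℝ) + 1) * q = π * (2 * r + 1) * q + π * q by ring,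
        show 2 * π * (r : ℝ) * q = π * (2 * r + 1) * q - π * q by ring, cos_add, cos_sub]
      ring
    have hc := continuous_sinRatio r
    simp_rw [h]
    rw [intervalIntegral.integral_add
        (Continuous.intervalIntegrable (by fun_prop) _ _)
        (Continuous.intervalIntegrable (by fun_prop) _ _),
      intervalIntegral.integral_add
        (Continuous.intervalIntegrable (by fun_prop) _ _)
        (Continuous.intervalIntegrable (by fun_prop) _ _),
      ih, integral_cos_mul_cos _ hk, integral_cos_mul_cos _ hk]
    rcases lt_trichotomy k r with hlt | rfl | hgt
    · simp [hlt, hlt.le, hlt.ne', show k < r + 1 by omega, show k ≤ r + 1 by omega,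
        show r + 1 ≠ k by omega]
    · norm_num
    · by_cases hkr : k = r + 1
      · simp [hkr]
      · simp [show ¬ k < r by omega, show ¬ k ≤ r by omega, show ¬ k ≤ r + 1 by omega,
          show ¬ k < r + 1 by omega, show r ≠ k by omega, show r + 1 ≠ k by omega]

/-- The series `∑ r⁻ᵐ sin (2 π r q)` divided by `sin (π q)`. -/
noncomputable def sinRatioSeries (m : ℕ) (q : ℝ) : ℝ := ∑' r : ℕ, 1 / (r : ℝ) ^ m * sinRatio r q

theorem norm_div_pow_mul_sinRatio_le {m : ℕ} (hm : 3 ≤ m) (r : ℕ) (q : ℝ) :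
    ‖1 / (r : ℝ) ^ m * sinRatio r q‖ ≤ 2 * (1 / (r : ℝ) ^ (m - 1)) := by
  rw [norm_mul, Real.norm_eq_abs, Real.norm_eq_abs, abs_of_nonneg (by positivity)]
  refine (mul_le_mul_of_nonneg_left (abs_sinRatio_le r q) (by positivity)).trans (le_of_eq ?_)
  rcases Nat.eq_zero_or_pos r with rfl | hr
  · simp [show m ≠ 0 by omega, show m - 1 ≠ 0 by omega]
  · obtain ⟨m, rfl⟩ : ∃ l, m = l + 1 := ⟨m - 1, by omega⟩
    have hr' : (r : ℝ) ≠ 0 := by positivity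
    rw [Nat.add_sub_cancel, pow_succ]
    field_simp

theorem summable_two_mul_one_div_pow {m : ℕ} (hm : 3 ≤ m) :
    Summable fun r : ℕ => 2 * (1 / (r : ℝ) ^ (m - 1)) :=
  (Real.summable_one_div_nat_pow.mpr (by omega)).mul_left 2

theorem hasSum_sinRatioSeries {m : ℕ} (hm : 3 ≤ m) (q : ℝ) :
    HasSum (fun r : ℕ => 1 / (r : ℝ) ^ m * sinRatio r q) (sinRatioSeries m q) :=
  (Summable.of_norm_bounded (summable_two_mul_one_div_pow hm)
    fun r => norm_div_pow_mul_sinRatio_le hm r q).hasSum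

theorem continuous_sinRatioSeries {m : ℕ} (hm : 3 ≤ m) : Continuous (sinRatioSeries m) :=
  continuous_tsum (fun r => continuous_const.mul (continuous_sinRatio r))
    (summable_two_mul_one_div_pow hm) (norm_div_pow_mul_sinRatio_le hm)

/-- The factor `κ` with `κ * B k q = ∑ r⁻ᵏ sin (2 π r q)` or `∑ r⁻ᵏ cos (2 π r q)`, according to the
parity of `k`. -/
noncomputable def fourierFactor (k : ℕ) : ℝ :=
  (-1 : ℝ) ^ ((k + 1) / 2 + k + 1) * (2 * π) ^ k / 2 / k.factorial

theorem hasSum_cos_B {n : ℕ} (hn : 2 ≤ n) (hne : Even n) {q : ℝ} (hq : q ∈ Set.Icc (0 : ℝ) 1) :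
    HasSum (fun k : ℕ => 1 / (k : ℝ) ^ n * cos (2 * π * k * q)) (fourierFactor n * B n q) := by
  obtain ⟨b, rfl⟩ := hne.two_dvd
  convert! hasSum_one_div_nat_pow_mul_cos (by omega : b ≠ 0) hq using 1
  rw [fourierFactor, B, Polynomial.eval_map_algebraMap,
    show (2 * b + 1) / 2 + 2 * b + 1 = 2 * b + (b + 1) by omega, pow_add _ (2 * b), pow_mul]
  simp

theorem sin_mul_sinRatioSeries {m : ℕ} (hm : 3 ≤ m) (hmo : Odd m) {q : ℝ}
    (hq : q ∈ Set.Icc (0 : ℝ) 1) :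
    sin (π * q) * sinRatioSeries m q = fourierFactor m * B m q := by
  have h := (hasSum_sinRatioSeries hm q).mul_left (sin (π * q))
  simp_rw [mul_left_comm, sin_mul_sinRatio] at h
  refine h.unique ?_
  obtain ⟨a, rfl⟩ := hmo
  convert! hasSum_one_div_nat_pow_mul_sin (by omega : a ≠ 0) hq using 1
  rw [fourierFactor, B, Polynomial.eval_map_algebraMap,
    show (2 * a + 1 + 1) / 2 + (2 * a + 1) + 1 = 2 * (a + 1) + (a + 1) by omega,
    pow_add _ (2 * (a + 1)), pow_mul]
  simp

theorem continuous_B (k : ℕ) : Continuous (B k) := Polynomial.continuous_aeval _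

theorem hasDerivAt_B (k : ℕ) (q : ℝ) : HasDerivAt (B k) (k * B (k - 1) q) q := by
  convert! (Polynomial.bernoulli k).hasDerivAt_aeval q using 1
  simp [Polynomial.derivative_bernoulli, B]

theorem intervalIntegrable_K : IntervalIntegrable K volume 0 1 := by
  have h := (intervalIntegrable_log_sin (a := 0) (b := π)).comp_mul_left (c := π)
  simpa [pi_ne_zero, Function.comp_def] using! h

theorem sin_pi_mul_pos {q : ℝ} (hq : q ∈ Set.Ioo (0 : ℝ) 1) : 0 < sin (π * q) :=
  sin_pos_of_pos_of_lt_pi (mul_pos pi_pos hq.1) (by nlinarith [pi_pos, hq.2])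

theorem hasDerivAt_K {q : ℝ} (hq : q ∈ Set.Ioo (0 : ℝ) 1) :
    HasDerivAt K (π * cos (π * q) / sin (π * q)) q := by
  have h := (((hasDerivAt_id q).const_mul π).sin).log (sin_pi_mul_pos hq).ne'
  convert! h using 1
  simp [mul_comm]

/-- Integration by parts against the logarithm of the sine. -/
theorem fourierFactor_mul_integral_eq {m : ℕ} (hm : 3 ≤ m) (hmo : Odd m) (n : ℕ) :
    fourierFactor m * (m * I_BB (m - 1) n + n * I_BB m (n - 1)) =
      -(π * ∫ q in (0 : ℝ)..1, sinRatioSeries m q * cos (π * q) * B n q) := by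
  have hE := continuous_sinRatioSeries hm
  have hB := continuous_B
  have hint : ∀ k l, IntervalIntegrable (fun q => B k q * B l q * K q) volume 0 1 := fun k l =>
    intervalIntegrable_K.continuousOn_mul ((hB k).mul (hB l)).continuousOn
  have hcot : IntervalIntegrable (fun q => sinRatioSeries m q * cos (π * q) * B n q)
      volume 0 1 :=
    Continuous.intervalIntegrable (by fun_prop) _ _
  have hcont : ContinuousOn (fun q => fourierFactor m * B m q * B n q * K q)
      (Set.Icc (0 : ℝ) 1) := by
    have hc : Continuous fun q : ℝ =>
        sinRatioSeries m q * B n q * (sin (π * q) * log (sin (π * q))) :=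
      (hE.mul (hB n)).mul
        (continuous_mul_log.comp (by fun_prop : Continuous fun q : ℝ => sin (π * q)))
    refine hc.continuousOn.congr fun q hq => ?_
    simp only [K, ← sin_mul_sinRatioSeries hm hmo hq]
    ring
  have hI : IntervalIntegrable (fun q => fourierFactor m * (m * (B (m - 1) q * B n q * K q) +
      n * (B m q * B (n - 1) q * K q)) + π * (sinRatioSeries m q * cos (π * q) * B n q))
      volume 0 1 :=
    ((((hint _ _).const_mul _).add ((hint _ _).const_mul _)).const_mul _).add (hcot.const_mul _)
  have hftc := intervalIntegral.integral_eq_sub_of_hasDerivAt_of_le zero_le_one hcont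
    (fun q hq => ?_) hI
  · rw [intervalIntegral.integral_add
        ((((hint _ _).const_mul _).add ((hint _ _).const_mul _)).const_mul _) (hcot.const_mul _),
      intervalIntegral.integral_const_mul, intervalIntegral.integral_const_mul,
      intervalIntegral.integral_add ((hint _ _).const_mul _) ((hint _ _).const_mul _),
      intervalIntegral.integral_const_mul, intervalIntegral.integral_const_mul] at hftc
    have h₀ : K 0 = 0 := by simp [K]
    have h₁ : K 1 = 0 := by simp [K]
    rw [h₀, h₁] at hftc
    simp only [I_BB]
    linarith
  · have hs := (sin_pi_mul_pos hq).ne'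
    have h := (((hasDerivAt_B m q).const_mul (fourierFactor m)).mul (hasDerivAt_B n q)).mul
      (hasDerivAt_K hq)
    convert! h using 1
    simp only [Pi.mul_apply]
    have hS := sin_mul_sinRatioSeries hm hmo (Set.Ioo_subset_Icc_self hq)
    rw [← hS]
    field_simp
    linear_combination -(K q * n * B (n - 1) q) * hS

theorem hasSum_integral_sinRatioSeries {m n : ℕ} (hm : 3 ≤ m) (hn : 2 ≤ n) (hne : Even n) :
    HasSum (fun p : ℕ × ℕ => 1 / (p.1 : ℝ) ^ m * (1 / (p.2 : ℝ) ^ n) *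
        ((if p.2 < p.1 then 1 / 2 else 0) + if p.2 ≤ p.1 then 1 / 2 else 0))
      (fourierFactor n * ∫ q in (0 : ℝ)..1, sinRatioSeries m q * cos (π * q) * B n q) := by
  have hbound : Summable fun p : ℕ × ℕ =>
      2 * (1 / (p.1 : ℝ) ^ (m - 1)) * (1 / (p.2 : ℝ) ^ n) :=
    (summable_two_mul_one_div_pow hm).mul_of_nonneg
      (Real.summable_one_div_nat_pow.mpr (by omega))
      (fun _ => by positivity) (fun _ => by positivity)
  have hterm : ∀ (p : ℕ × ℕ) (q : ℝ), ‖1 / (p.1 : ℝ) ^ m * sinRatio p.1 q * cos (π * q) *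
      (1 / (p.2 : ℝ) ^ n * cos (2 * π * p.2 * q))‖ ≤
        2 * (1 / (p.1 : ℝ) ^ (m - 1)) * (1 / (p.2 : ℝ) ^ n) := by
    intro p q
    rw [norm_mul, norm_mul]
    refine mul_le_mul ?_ ?_ (norm_nonneg _) (by positivity)
    · calc _ ≤ ‖1 / (p.1 : ℝ) ^ m * sinRatio p.1 q‖ * 1 := by
            exact mul_le_mul_of_nonneg_left (abs_cos_le_one _) (norm_nonneg _)
        _ ≤ _ := by
            rw [mul_one]
            exact norm_div_pow_mul_sinRatio_le hm _ _
    · rw [norm_mul, Real.norm_of_nonneg (by positivity : (0 : ℝ) ≤ 1 / (p.2 : ℝ) ^ n)]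
      exact mul_le_of_le_one_right (by positivity) (abs_cos_le_one _)
  have key := intervalIntegral.hasSum_integral_of_dominated_convergence
    (μ := volume) (a := 0) (b := 1)
    (F := fun (p : ℕ × ℕ) (q : ℝ) => 1 / (p.1 : ℝ) ^ m * sinRatio p.1 q * cos (π * q) *
      (1 / (p.2 : ℝ) ^ n * cos (2 * π * p.2 * q)))
    (f := fun q => sinRatioSeries m q * cos (π * q) * (fourierFactor n * B n q))
    (fun p _ => 2 * (1 / (p.1 : ℝ) ^ (m - 1)) * (1 / (p.2 : ℝ) ^ n))
    (fun p => by
      have hc := continuous_sinRatio p.1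
      exact Continuous.aestronglyMeasurable (by fun_prop))
    (fun p => ae_of_all _ fun q _ => hterm p q)
    (ae_of_all _ fun _ _ => hbound)
    intervalIntegrable_const
    (ae_of_all _ fun q hq => by
      rw [Set.uIoc_of_le zero_le_one] at hq
      exact ((hasSum_sinRatioSeries hm q).mul_right (cos (π * q))).mul
        (hasSum_cos_B hn hne (Set.Ioc_subset_Icc_self hq))
        (Summable.of_norm_bounded hbound fun p => hterm p q))
  convert! key using 1
  · funext p
    rcases eq_or_ne p.2 0 with h | h
    · simp [h, show n ≠ 0 by omega]
    · rw [← integral_sinRatio_mul_cos_mul_cos p.1 h, ← intervalIntegral.integral_const_mul]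
      congr 1 with q
      ring
  · rw [← intervalIntegral.integral_const_mul]
    congr 1 with q
    ring

theorem rzeta_natCast {k : ℕ} (hk : 2 ≤ k) : rzeta k = ∑' r : ℕ, 1 / (r : ℝ) ^ k := by
  have h : (∑' r : ℕ, 1 / (r : ℂ) ^ k) = ((∑' r : ℕ, 1 / (r : ℝ) ^ k : ℝ) : ℂ) := by
    push_cast
    rfl
  rw [rzeta, Complex.ofReal_natCast, zeta_nat_eq_tsum_of_gt_one hk, h, Complex.ofReal_re]

theorem summable_one_div_pow_mul_one_div_pow {m n : ℕ} (hm : 2 ≤ m) (hn : 2 ≤ n) :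
    Summable fun p : ℕ × ℕ => 1 / (p.1 : ℝ) ^ m * (1 / (p.2 : ℝ) ^ n) :=
  (Real.summable_one_div_nat_pow.mpr (by omega)).mul_of_nonneg
    (Real.summable_one_div_nat_pow.mpr (by omega))
    (fun _ => by positivity) (fun _ => by positivity)

theorem T_zero_eq_tsum {m n : ℕ} (hm : 2 ≤ m) (hn : 2 ≤ n) :
    T m 0 n = ∑' p : ℕ × ℕ,
      if p.1 < p.2 then 1 / (p.1 : ℝ) ^ m * (1 / (p.2 : ℝ) ^ n) else 0 := by
  let g : ℕ+ × ℕ+ → ℕ × ℕ := fun p => (p.1, p.1 + p.2)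
  have hg : Function.Injective g := by
    rintro ⟨r, s⟩ ⟨r', s'⟩ h
    simp only [g, Prod.mk.injEq, PNat.coe_inj] at h
    obtain ⟨rfl, h⟩ := h
    simpa using h
  have hsupp : Function.support (fun p : ℕ × ℕ =>
      if p.1 < p.2 then 1 / (p.1 : ℝ) ^ m * (1 / (p.2 : ℝ) ^ n) else 0) ⊆ Set.range g := by
    rintro ⟨r, k⟩ h
    have hlt : r < k := by
      by_contra hlt
      simp [hlt] at h
    have hr : 0 < r := by
      rcases Nat.eq_zero_or_pos r with rfl | hr
      · simp [show m ≠ 0 by omega] at h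
      · exact hr
    exact ⟨(⟨r, hr⟩, ⟨k - r, by omega⟩), by simp [g]; omega⟩
  have hterm : ∀ p : ℕ+ × ℕ+, (if (g p).1 < (g p).2 then
      1 / ((g p).1 : ℝ) ^ m * (1 / ((g p).2 : ℝ) ^ n) else 0) =
      1 / ((p.1 : ℝ) ^ (m : ℝ) * (p.2 : ℝ) ^ (0 : ℝ) * ((p.1 : ℝ) + (p.2 : ℝ)) ^ (n : ℝ)) := by
    intro p
    simp [g, rpow_natCast, mul_comm]
  have hsum := (summable_one_div_pow_mul_one_div_pow hm hn).comp_injective hg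
  rw [← hg.tsum_eq hsupp]
  simp_rw [hterm]
  rw [T, Summable.tsum_prod]
  refine hsum.congr fun p => ?_
  rw [← hterm]
  simp [g]

theorem rzeta_add_eq_tsum {m n : ℕ} (hm : 2 ≤ m) :
    rzeta (m + n) = ∑' p : ℕ × ℕ,
      if p.1 = p.2 then 1 / (p.1 : ℝ) ^ m * (1 / (p.2 : ℝ) ^ n) else 0 := by
  have hg : Function.Injective fun r : ℕ => (r, r) := fun r s h => (Prod.mk.inj h).1
  rw [← Nat.cast_add, rzeta_natCast (by omega), ← hg.tsum_eq]
  · simp [pow_add, mul_comm]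
  · rintro ⟨r, k⟩ h
    have hrk : r = k := by
      by_contra hrk
      simp [hrk] at h
    exact ⟨r, by simp [hrk]⟩

theorem T_zero_eq_sub_integral {m n : ℕ} (hm : 3 ≤ m) (hn : 2 ≤ n) (hne : Even n) :
    T m 0 n = rzeta m * rzeta n - (1 / 2) * rzeta (m + n) -
      fourierFactor n * ∫ q in (0 : ℝ)..1, sinRatioSeries m q * cos (π * q) * B n q := by
  have hs := summable_one_div_pow_mul_one_div_pow (by omega : 2 ≤ m) hn
  have hlt : Summable fun p : ℕ × ℕ =>
      if p.1 < p.2 then 1 / (p.1 : ℝ) ^ m * (1 / (p.2 : ℝ) ^ n) else 0 :=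
    (hs.indicator {p : ℕ × ℕ | p.1 < p.2}).congr fun p => by simp [Set.indicator_apply]
  have heq : Summable fun p : ℕ × ℕ =>
      if p.1 = p.2 then 1 / (p.1 : ℝ) ^ m * (1 / (p.2 : ℝ) ^ n) else 0 :=
    (hs.indicator {p : ℕ × ℕ | p.1 = p.2}).congr fun p => by simp [Set.indicator_apply]
  have hprod : rzeta m * rzeta n =
      ∑' p : ℕ × ℕ, 1 / (p.1 : ℝ) ^ m * (1 / (p.2 : ℝ) ^ n) := by
    rw [rzeta_natCast (by omega), rzeta_natCast hn]
    exact (Real.summable_one_div_nat_pow.mpr (by omega)).tsum_mul_tsum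
      (Real.summable_one_div_nat_pow.mpr (by omega)) hs
  have hI := hasSum_integral_sinRatioSeries hm hn hne
  have htot := (hs.hasSum.sub (heq.hasSum.mul_left (1 / 2))).sub hlt.hasSum
  rw [← hprod, ← rzeta_add_eq_tsum (by omega), ← T_zero_eq_tsum (by omega) hn] at htot
  have := hI.unique (htot.congr_fun fun p => ?_)
  · linarith
  · rcases lt_trichotomy p.1 p.2 with h | h | h
    · simp [h, h.ne, h.not_gt, h.not_ge]
    · simp [h]
      ring
    · simp [h, h.ne', h.le, h.not_gt]
      ring

theorem tornheim_T_m_0_n_odd_even (m n : ℕ) (hm : 2 ≤ m) (hn : 2 ≤ n)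
    (hmo : Odd m) (hne : Even n) :
    T m 0 n = rzeta m * rzeta n - (1 / 2) * rzeta (m + n) +
      (-1 : ℝ) ^ ((m + n) / 2) * ((2 * π) ^ (m + n - 1) / (m.factorial * n.factorial)) *
        ((1 / 2) * (m * I_BB (m - 1) n + n * I_BB m (n - 1))) := by
  have hm3 : 3 ≤ m := by
    obtain ⟨a, rfl⟩ := hmo
    omega
  have hparts := fourierFactor_mul_integral_eq hm3 hmo n
  rw [T_zero_eq_sub_integral hm3 hn hne]
  set X : ℝ := m * I_BB (m - 1) n + n * I_BB m (n - 1)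
  set Y := ∫ q in (0 : ℝ)..1, sinRatioSeries m q * cos (π * q) * B n q
  have hfactor : fourierFactor n * fourierFactor m =
      π * ((-1 : ℝ) ^ ((m + n) / 2) * ((2 * π) ^ (m + n - 1) / (m.factorial * n.factorial)) *
        (1 / 2)) := by
    obtain ⟨a, rfl⟩ := hmo
    obtain ⟨b, rfl⟩ := hne.two_dvd
    rw [fourierFactor, fourierFactor,
      show (2 * b + 1) / 2 + 2 * b + 1 = 2 * b + (b + 1) by omega,
      show (2 * a + 1 + 1) / 2 + (2 * a + 1) + 1 = 2 * (a + 1) + (a + 1) by omega,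
      show (2 * a + 1 + 2 * b) / 2 = a + b by omega,
      show 2 * a + 1 + 2 * b - 1 = 2 * a + 2 * b by omega]
    simp only [pow_add, pow_mul (-1 : ℝ), neg_one_sq, one_pow]
    field_simp
  have hY : Y = -(fourierFactor m * X) / π := by
    rw [hparts]
    field_simp
  rw [hY]
  have : fourierFactor n * (-(fourierFactor m * X) / π) =
      -(fourierFactor n * fourierFactor m) * X / π := by ring
  rw [this, hfactor]
  field_simp
  ring
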